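/- Consider the rigid system (E') with b1 = 0 and a quartic term a4*y^3 allowed, i.e. G(x,y) = b2*y + a1*x^3 + a2*x^2*y + a3*x*y^2 + a4*y^3 and the ODE x' = -y + x*G(x,y), y' = x + y*G(x,y). If a1*a3 ≥ 0, then the system (E') has no limit cycles. -/

import Mathlib

/-- The function `G` of the rigid system (E') with `b1 = 0` and quartic term `a4*y^3`. -/
noncomputable def Gfun (b2 a1 a2 a3 a4 x y : ℝ) : ℝ :=
  b2*y + a1*x^3 + a2*x^2*y + a3*x*y^2 + a4*y^3

/-- First component of the vector field of (E'). -/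
noncomputable def Pfun' (b2 a1 a2 a3 a4 x y : ℝ) : ℝ :=
  -y + x * Gfun b2 a1 a2 a3 a4 x y

/-- Second component of the vector field of (E'). -/
noncomputable def Qfun' (b2 a1 a2 a3 a4 x y : ℝ) : ℝ :=
  x + y * Gfun b2 a1 a2 a3 a4 x y

/-- `f : ℝ → ℝ × ℝ` is a (global) solution of the system (E'). -/
def IsSolutionE' (b2 a1 a2 a3 a4 : ℝ) (f : ℝ → ℝ × ℝ) : Prop :=
  ∀ t : ℝ, HasDerivAt f
    (Pfun' b2 a1 a2 a3 a4 (f t).1 (f t).2, Qfun' b2 a1 a2 a3 a4 (f t).1 (f t).2) t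

/-- `f` is a non-constant periodic solution of the system (E'). -/
def IsPeriodicOrbitE' (b2 a1 a2 a3 a4 : ℝ) (f : ℝ → ℝ × ℝ) : Prop :=
  IsSolutionE' b2 a1 a2 a3 a4 f ∧ (∃ T > (0:ℝ), ∀ t, f (t + T) = f t) ∧
    (∃ t s : ℝ, f t ≠ f s)

/-- `f` is a limit cycle of the system (E'). -/
def IsLimitCycleE' (b2 a1 a2 a3 a4 : ℝ) (f : ℝ → ℝ × ℝ) : Prop :=
  IsPeriodicOrbitE' b2 a1 a2 a3 a4 f ∧
    ∃ U : Set (ℝ × ℝ), IsOpen U ∧ Set.range f ⊆ U ∧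
      ∀ g : ℝ → ℝ × ℝ, IsPeriodicOrbitE' b2 a1 a2 a3 a4 g →
        Set.range g ⊆ U → Set.range g = Set.range f

open Real Set

/-- A function with `D' = g * D`, for a continuous `g`, is a multiple of an exponential. -/
theorem eq_mul_exp_integral_of_hasDerivAt {g D : ℝ → ℝ} (hg : Continuous g)
    (hD : ∀ t, HasDerivAt D (g t * D t) t) (t : ℝ) :
    D t = D 0 * exp (∫ s in (0 : ℝ)..t, g s) := by
  have hI : ∀ t, HasDerivAt (fun t => ∫ s in (0 : ℝ)..t, g s) (g t) t := fun t =>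
    intervalIntegral.integral_hasDerivAt_right (hg.intervalIntegrable _ _)
      (hg.stronglyMeasurableAtFilter _ _) hg.continuousAt
  have hW : ∀ t, HasDerivAt (fun t => D t * exp (-∫ s in (0 : ℝ)..t, g s)) 0 t := fun t => by
    refine ((hD t).mul (hI t).neg.exp).congr_deriv ?_
    ring
  have hc := is_const_of_deriv_eq_zero (fun t => (hW t).differentiableAt)
    (fun t => (hW t).deriv) t 0
  simp only [intervalIntegral.integral_same, neg_zero, exp_zero, mul_one] at hc
  rw [← hc, mul_assoc, ← exp_add, neg_add_cancel, exp_zero, mul_one]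

/-- A continuous periodic function attains its minimum and its maximum. -/
theorem exists_forall_le_and_exists_forall_ge {u : ℝ → ℝ} (hu : Continuous u) {T : ℝ} (hT : 0 < T)
    (hper : Function.Periodic u T) : (∃ s, ∀ t, u s ≤ u t) ∧ ∃ s, ∀ t, u t ≤ u s := by
  have hc := hper.compact_of_continuous hT.ne' hu
  obtain ⟨_, ⟨s, rfl⟩, hs⟩ := hc.exists_isLeast (range_nonempty u)
  obtain ⟨_, ⟨r, rfl⟩, hr⟩ := hc.exists_isGreatest (range_nonempty u)
  exact ⟨⟨s, fun t => hs (mem_range_self t)⟩, r, fun t => hr (mem_range_self t)⟩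

/-- The cubic part of `G` on the unit circle. -/
noncomputable def cubicCoeff (a1 a2 a3 a4 t : ℝ) : ℝ :=
  a1 * cos t ^ 3 + a2 * cos t ^ 2 * sin t + a3 * cos t * sin t ^ 2 + a4 * sin t ^ 3

theorem continuous_cubicCoeff (a1 a2 a3 a4 : ℝ) : Continuous (cubicCoeff a1 a2 a3 a4) := by
  unfold cubicCoeff
  fun_prop

/-- `u` is the inverse of the radius along an orbit of (E'), as a function of the angle. -/
def IsInverseRadius (b2 a1 a2 a3 a4 : ℝ) (u : ℝ → ℝ) : Prop :=
  (∀ t, 0 < u t) ∧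
    ∀ t, HasDerivAt u (-(b2 * sin t) - cubicCoeff a1 a2 a3 a4 t / u t ^ 2) t

/-- The curve at angle `t` and radius `1 / u t`. -/
noncomputable def polarCurve (u : ℝ → ℝ) (t : ℝ) : ℝ × ℝ :=
  (cos t / u t, sin t / u t)

theorem polarCurve_sq_add_sq (u : ℝ → ℝ) (t : ℝ) :
    (polarCurve u t).1 ^ 2 + (polarCurve u t).2 ^ 2 = 1 / u t ^ 2 := by
  simp only [polarCurve, div_pow, ← add_div, cos_sq_add_sin_sq]

namespace IsInverseRadius

variable {b2 a1 a2 a3 a4 : ℝ} {u v : ℝ → ℝ}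

theorem continuous (hu : IsInverseRadius b2 a1 a2 a3 a4 u) : Continuous u :=
  continuous_iff_continuousAt.2 fun t => (hu.2 t).continuousAt

theorem isSolutionE' (hu : IsInverseRadius b2 a1 a2 a3 a4 u) :
    IsSolutionE' b2 a1 a2 a3 a4 (polarCurve u) := by
  intro t
  have h0 := (hu.1 t).ne'
  have h1 := (hasDerivAt_cos t).div (hu.2 t) h0
  have h2 := (hasDerivAt_sin t).div (hu.2 t) h0
  refine (h1.prodMk h2).congr_deriv ?_
  simp only [polarCurve, Pfun', Qfun', Gfun, cubicCoeff, Prod.mk.injEq]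
  constructor <;> field_simp <;> ring

theorem isPeriodicOrbitE' (hu : IsInverseRadius b2 a1 a2 a3 a4 u) {T : ℝ} (hT : 0 < T)
    (hper : ∀ t, polarCurve u (t + T) = polarCurve u t) :
    IsPeriodicOrbitE' b2 a1 a2 a3 a4 (polarCurve u) := by
  refine ⟨hu.isSolutionE', ⟨T, hT, hper⟩, 0, π, fun h => ?_⟩
  have h1 := congrArg Prod.fst h
  simp only [polarCurve, cos_zero, cos_pi] at h1
  have h2 := div_pos one_pos (hu.1 0)
  have h3 := div_pos one_pos (hu.1 π)
  rw [neg_div] at h1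
  linarith

theorem comp_add_two_pi (hu : IsInverseRadius b2 a1 a2 a3 a4 u) :
    IsInverseRadius b2 a1 a2 a3 a4 (fun t => u (t + 2 * π)) := by
  refine ⟨fun t => hu.1 _, fun t => ?_⟩
  have h := (hu.2 (t + 2 * π)).comp_add_const t (2 * π)
  simpa only [cubicCoeff, sin_add_two_pi, cos_add_two_pi] using h

theorem comp_neg (hu : IsInverseRadius b2 a1 a2 a3 a4 u) :
    IsInverseRadius b2 (-a1) a2 (-a3) a4 (fun t => u (-t)) := by
  refine ⟨fun t => hu.1 _, fun t => ?_⟩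
  have h := (hu.2 (-t)).scomp t (hasDerivAt_neg t)
  simp only [cubicCoeff, sin_neg, cos_neg, smul_eq_mul, Function.comp_def] at h ⊢
  refine h.congr_deriv ?_
  ring

theorem sub_eq_mul_exp (hu : IsInverseRadius b2 a1 a2 a3 a4 u)
    (hv : IsInverseRadius b2 a1 a2 a3 a4 v) :
    ∃ I : ℝ → ℝ, ∀ t, v t - u t = (v 0 - u 0) * exp (I t) := by
  have hA := continuous_cubicCoeff a1 a2 a3 a4
  have hcu := hu.continuous
  have hcv := hv.continuous
  refine ⟨_, eq_mul_exp_integral_of_hasDerivAt (D := fun t => v t - u t)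
    (g := fun t => cubicCoeff a1 a2 a3 a4 t * (v t + u t) / (u t ^ 2 * v t ^ 2)) ?_ ?_⟩
  · have : ∀ t, u t ^ 2 * v t ^ 2 ≠ 0 := fun t =>
      (mul_pos (pow_pos (hu.1 t) 2) (pow_pos (hv.1 t) 2)).ne'
    fun_prop (disch := assumption)
  · intro t
    have h1 := (hu.1 t).ne'
    have h2 := (hv.1 t).ne'
    refine ((hv.2 t).sub (hu.2 t)).congr_deriv ?_
    field_simp
    ring

theorem lt_of_lt (hu : IsInverseRadius b2 a1 a2 a3 a4 u)
    (hv : IsInverseRadius b2 a1 a2 a3 a4 v) (h : u 0 < v 0) (t : ℝ) : u t < v t := by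
  obtain ⟨I, hI⟩ := hu.sub_eq_mul_exp hv
  have := mul_pos (sub_pos.2 h) (exp_pos (I t))
  linarith [hI t]

/-- A periodic inverse radius, of whatever period, has period `2π`. -/
theorem periodic_two_pi (hu : IsInverseRadius b2 a1 a2 a3 a4 u) {T : ℝ} (hT : 0 < T)
    (hper : Function.Periodic u T) : Function.Periodic u (2 * π) := by
  obtain ⟨⟨s, hs⟩, r, hr⟩ := exists_forall_le_and_exists_forall_ge hu.continuous hT hper
  obtain ⟨I, hI⟩ := hu.sub_eq_mul_exp hu.comp_add_two_pi
  have h1 : 0 ≤ u (0 + 2 * π) - u 0 :=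
    nonneg_of_mul_nonneg_left (by linarith [hI s, hs (s + 2 * π)]) (exp_pos (I s))
  have h2 : u (0 + 2 * π) - u 0 ≤ 0 := by
    by_contra! h
    linarith [hI r, hr (r + 2 * π), mul_pos h (exp_pos (I r))]
  intro t
  have := hI t
  rw [le_antisymm h2 h1, zero_mul] at this
  linarith

/-- Along a periodic orbit the upper half is strictly farther from the origin than the
reflected lower half. -/
theorem le_comp_neg_and_lt (hu : IsInverseRadius b2 a1 a2 a3 a4 u)
    (hper : Function.Periodic u (2 * π)) (h1 : 0 ≤ a1) (h3 : 0 ≤ a3) (h13 : 0 < a1 + a3) :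
    (∀ t ∈ Icc 0 π, u t ≤ u (-t)) ∧ u (π / 2) < u (-(π / 2)) := by
  have hv := hu.comp_neg
  have hcu := hu.continuous
  have hpi := pi_pos
  have hupi : u (-π) = u π := by
    rw [← hper (-π)]
    congr 1
    ring
  set g : ℝ → ℝ := fun t =>
    (a2 * cos t ^ 2 * sin t + a4 * sin t ^ 3) * (u t + u (-t)) / (u t ^ 2 * u (-t) ^ 2) with hgdef
  have hg : Continuous g := by
    have : ∀ t, u t ^ 2 * u (-t) ^ 2 ≠ 0 := fun t =>
      (mul_pos (pow_pos (hu.1 t) 2) (pow_pos (hu.1 (-t)) 2)).ne'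
    fun_prop (disch := assumption)
  set I : ℝ → ℝ := fun t => ∫ s in (0 : ℝ)..t, g s
  have hI : ∀ t, HasDerivAt I (g t) t := fun t =>
    intervalIntegral.integral_hasDerivAt_right (hg.intervalIntegrable _ _)
      (hg.stronglyMeasurableAtFilter _ _) hg.continuousAt
  set W : ℝ → ℝ := fun t => (u t - u (-t)) * exp (-I t) with hWdef
  set k : ℝ → ℝ := fun t => (a1 * cos t ^ 2 + a3 * sin t ^ 2) *
    (1 / u t ^ 2 + 1 / u (-t) ^ 2) * exp (-I t) with hkdef
  have hW : ∀ t, HasDerivAt W (-(cos t * k t)) t := fun t => by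
    have e1 := (hu.1 t).ne'
    have e2 := (hu.1 (-t)).ne'
    refine (((hu.2 t).sub (hv.2 t)).mul (hI t).neg.exp).congr_deriv ?_
    simp only [hkdef, hgdef, cubicCoeff, Pi.sub_apply, Pi.neg_apply]
    field_simp
    ring
  have hWc : Continuous W := continuous_iff_continuousAt.2 fun t => (hW t).continuousAt
  have hk : ∀ t, 0 ≤ k t := fun t => by
    have := hu.1 t
    have := hu.1 (-t)
    positivity
  have hW0 : W 0 = 0 := by simp [hWdef]
  have hWpi : W π = 0 := by simp [hWdef, hupi]
  have hanti : StrictAntiOn W (Icc 0 (π / 2)) := by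
    refine strictAntiOn_of_hasDerivWithinAt_neg (convex_Icc _ _) hWc.continuousOn
      (fun t _ => (hW t).hasDerivWithinAt) fun t ht => ?_
    rw [interior_Icc] at ht
    have hc : 0 < cos t := cos_pos_of_mem_Ioo ⟨by linarith [ht.1], ht.2⟩
    have hs : 0 < sin t := sin_pos_of_pos_of_lt_pi ht.1 (by linarith [ht.2])
    have hpos : 0 < a1 * cos t ^ 2 + a3 * sin t ^ 2 := by
      rcases h1.eq_or_lt with h | h
      · rw [← h, zero_add] at h13
        rw [← h]
        positivity
      · positivity
    have := hu.1 t
    have := hu.1 (-t)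
    have : 0 < k t := by positivity
    have := mul_pos hc this
    linarith
  have hmono : MonotoneOn W (Icc (π / 2) π) := by
    refine monotoneOn_of_hasDerivWithinAt_nonneg (convex_Icc _ _) hWc.continuousOn
      (fun t _ => (hW t).hasDerivWithinAt) fun t ht => ?_
    rw [interior_Icc] at ht
    have hc : cos t ≤ 0 := cos_nonpos_of_pi_div_two_le_of_le ht.1.le (by linarith [ht.2])
    have := mul_nonneg (neg_nonneg.2 hc) (hk t)
    linarith
  constructor
  · intro t ht
    have hWt : W t ≤ 0 := by
      rcases le_total t (π / 2) with h | h
      · rw [← hW0]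
        exact hanti.antitoneOn ⟨le_rfl, by positivity⟩ ⟨ht.1, h⟩ ht.1
      · rw [← hWpi]
        exact hmono ⟨h, ht.2⟩ ⟨by linarith, le_rfl⟩ ht.2
    by_contra! h
    linarith [mul_pos (sub_pos.2 h) (exp_pos (-I t))]
  · have hWt : W (π / 2) < 0 := by
      rw [← hW0]
      exact hanti ⟨le_rfl, by positivity⟩ ⟨by positivity, le_rfl⟩ (by positivity)
    by_contra! h
    linarith [mul_nonneg (sub_nonneg.2 h) (exp_pos (-I (π / 2))).le]

theorem not_periodic (hu : IsInverseRadius b2 a1 a2 a3 a4 u) (hb : b2 ≠ 0) (h1 : 0 ≤ a1)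
    (h3 : 0 ≤ a3) (h13 : 0 < a1 + a3) : ¬ Function.Periodic u (2 * π) := by
  intro hper
  obtain ⟨hle, hlt⟩ := hu.le_comp_neg_and_lt hper h1 h3 h13
  have hv := hu.comp_neg
  have hpi := pi_pos
  have hupi : u (-π) = u π := by
    rw [← hper (-π)]
    congr 1
    ring
  set Z : ℝ → ℝ := fun t => b2 * (u t ^ 3 - u (-t) ^ 3 +
    6 * (a1 * (sin t - sin t ^ 3 / 3) + a3 * sin t ^ 3 / 3)) with hZdef
  have hZ : ∀ t, HasDerivAt Z (3 * b2 ^ 2 * sin t * (u (-t) ^ 2 - u t ^ 2)) t := fun t => by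
    have e1 := (hu.1 t).ne'
    have e2 := (hu.1 (-t)).ne'
    have hs := hasDerivAt_sin t
    refine (((((hu.2 t).pow 3).sub ((hv.2 t).pow 3)).add
      (((((hs.sub ((hs.pow 3).div_const 3)).const_mul a1).add
        (((hs.pow 3).const_mul a3).div_const 3)).const_mul 6))).const_mul b2).congr_deriv ?_
    have hc : cos t ^ 3 = cos t * (1 - sin t ^ 2) := by rw [← cos_sq', pow_succ']
    simp only [cubicCoeff, hc]
    field_simp
    push_cast
    ring
  have hZc : Continuous Z := continuous_iff_continuousAt.2 fun t => (hZ t).continuousAt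
  have hmono : MonotoneOn Z (Icc 0 π) := by
    refine monotoneOn_of_hasDerivWithinAt_nonneg (convex_Icc _ _) hZc.continuousOn
      (fun t _ => (hZ t).hasDerivWithinAt) fun t ht => ?_
    rw [interior_Icc] at ht
    have hs := sin_pos_of_pos_of_lt_pi ht.1 ht.2
    have := pow_le_pow_left₀ (hu.1 t).le (hle t ⟨ht.1.le, ht.2.le⟩) 2
    have := sub_nonneg.2 this
    positivity
  have hZ0 : Z 0 = 0 := by simp [hZdef]
  have hZpi : Z π = 0 := by simp [hZdef, hupi]
  have hconst : ∀ t ∈ Icc 0 π, Z t = 0 := fun t ht => le_antisymm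
    (hZpi ▸ hmono ht ⟨hpi.le, le_rfl⟩ ht.2) (hZ0 ▸ hmono ⟨le_rfl, hpi.le⟩ ht ht.1)
  have hev : Z =ᶠ[nhds (π / 2)] fun _ => 0 :=
    Filter.eventually_of_mem (Icc_mem_nhds (by positivity) (by linarith)) hconst
  have hder := (hZ (π / 2)).unique ((hasDerivAt_const (π / 2) (0 : ℝ)).congr_of_eventuallyEq hev)
  rw [sin_pi_div_two] at hder
  have hsq := sub_pos.2 (pow_lt_pow_left₀ hlt (hu.1 _).le two_ne_zero)
  have : 0 < 3 * b2 ^ 2 * 1 * (u (-(π / 2)) ^ 2 - u (π / 2) ^ 2) := by positivity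
  linarith

/-- If the orbits near a periodic orbit are periodic, that orbit is not isolated. -/
theorem exists_isPeriodicOrbitE'_range_ne (hu : IsInverseRadius b2 a1 a2 a3 a4 u) {T : ℝ}
    (hT : 0 < T) (hper : Function.Periodic (polarCurve u) T) (huT : Function.Periodic u T)
    (hv : ∀ ε > 0, ∃ v, IsInverseRadius b2 a1 a2 a3 a4 v ∧
      Function.Periodic (polarCurve v) T ∧ ∀ t, u t < v t ∧ v t < u t + ε)
    {U : Set (ℝ × ℝ)} (hU : IsOpen U) (hsub : range (polarCurve u) ⊆ U) :
    ∃ g, IsPeriodicOrbitE' b2 a1 a2 a3 a4 g ∧ range g ⊆ U ∧ range g ≠ range (polarCurve u) := by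
  have hcont : Continuous (polarCurve u) :=
    continuous_iff_continuousAt.2 fun t => (hu.isSolutionE' t).continuousAt
  obtain ⟨δ, hδ, hthick⟩ :=
    (hper.compact_of_continuous hT.ne' hcont).exists_thickening_subset_open hU hsub
  obtain ⟨s, hs⟩ := (exists_forall_le_and_exists_forall_ge hu.continuous hT huT).1
  have hm := hu.1 s
  obtain ⟨v, hvr, hvp, hvu⟩ := hv (δ * u s ^ 2) (by positivity)
  refine ⟨polarCurve v, hvr.isPeriodicOrbitE' hT hvp, ?_, ?_⟩
  · rintro _ ⟨t, rfl⟩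
    refine hthick (Metric.mem_thickening_iff.2 ⟨_, mem_range_self t, ?_⟩)
    have h1 := hu.1 t
    have h2 := hvr.1 t
    obtain ⟨h3, h4⟩ := hvu t
    have key : |1 / v t - 1 / u t| < δ := by
      rw [abs_sub_comm, abs_of_nonneg (sub_nonneg.2 (one_div_le_one_div_of_le h1 h3.le)),
        div_sub_div _ _ h1.ne' h2.ne', div_lt_iff₀ (by positivity)]
      have : u s * u s ≤ u t * v t := mul_le_mul (hs t) ((hs t).trans h3.le) hm.le h1.le
      have := mul_le_mul_of_nonneg_left this hδ.le
      linarith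
    have aux : ∀ c : ℝ, |c| ≤ 1 → |c / v t - c / u t| < δ := fun c hc => by
      have e : c / v t - c / u t = c * (1 / v t - 1 / u t) := by ring
      rw [e, abs_mul]
      exact (mul_le_of_le_one_left (abs_nonneg _) hc).trans_lt key
    rw [Prod.dist_eq, max_lt_iff, Real.dist_eq, Real.dist_eq]
    exact ⟨aux _ (abs_cos_le_one t), aux _ (abs_sin_le_one t)⟩
  · intro h
    obtain ⟨t, ht⟩ := h.ge (mem_range_self s)
    have h1 := polarCurve_sq_add_sq v t
    rw [ht, polarCurve_sq_add_sq] at h1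
    have h2 : u s < v t := (hs t).trans_lt (hvu t).1
    have h3 := one_div_lt_one_div_of_lt (pow_pos hm 2) (pow_lt_pow_left₀ h2 hm.le two_ne_zero)
    linarith

theorem periodic_of_periodic_polarCurve (hu : IsInverseRadius b2 a1 a2 a3 a4 u) {T : ℝ}
    (hper : Function.Periodic (polarCurve u) T) :
    Function.Periodic u T ∧ Function.Periodic cos T ∧ Function.Periodic sin T := by
  have huT : Function.Periodic u T := fun t => by
    have h := polarCurve_sq_add_sq u (t + T)
    rw [hper t, polarCurve_sq_add_sq] at h
    have h1 := pow_pos (hu.1 t) 2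
    have h2 := pow_pos (hu.1 (t + T)) 2
    rw [one_div, one_div, inv_inj] at h
    exact (pow_left_inj₀ (hu.1 _).le (hu.1 _).le two_ne_zero).1 h.symm
  refine ⟨huT, fun t => ?_, fun t => ?_⟩
  · have h := congrArg Prod.fst (hper t)
    simp only [polarCurve, huT t] at h
    exact (div_left_inj' (hu.1 t).ne').1 h
  · have h := congrArg Prod.snd (hper t)
    simp only [polarCurve, huT t] at h
    exact (div_left_inj' (hu.1 t).ne').1 h

/-- When `b2 = 0` the cube of the inverse radius is determined up to an additive constant. -/
theorem exists_near_of_linear_eq_zero (hu : IsInverseRadius 0 a1 a2 a3 a4 u) {T : ℝ}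
    (huT : Function.Periodic u T) {ε : ℝ} (hε : 0 < ε) :
    ∃ v, IsInverseRadius 0 a1 a2 a3 a4 v ∧ Function.Periodic v T ∧
      ∀ t, u t < v t ∧ v t < u t + ε := by
  have hpos : ∀ t, 0 < u t ^ 3 + ε ^ 3 := fun t => by
    have := hu.1 t
    positivity
  have hcube : ∀ t, ((u t ^ 3 + ε ^ 3) ^ (1 / 3 : ℝ)) ^ 3 = u t ^ 3 + ε ^ 3 := fun t => by
    rw [← rpow_natCast, ← rpow_mul (hpos t).le]
    norm_num
  have hv : ∀ t, 0 < (u t ^ 3 + ε ^ 3) ^ (1 / 3 : ℝ) := fun t => rpow_pos_of_pos (hpos t) _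
  refine ⟨fun t => (u t ^ 3 + ε ^ 3) ^ (1 / 3 : ℝ), ⟨hv, fun t => ?_⟩, fun t => ?_, fun t => ?_⟩
  · refine ((((hu.2 t).pow 3).add_const (ε ^ 3)).rpow_const (p := 1 / 3)
      (Or.inl (hpos t).ne')).congr_deriv ?_
    have h0 := (hu.1 t).ne'
    have h1 := (hv t).ne'
    have h2 := (hpos t).ne'
    simp only [Pi.pow_apply]
    rw [rpow_sub_one h2]
    nth_rewrite 2 [← hcube t]
    push_cast
    field_simp
    ring
  · simp only [huT t]
  · have h0 := hu.1 t
    constructor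
    · refine lt_of_pow_lt_pow_left₀ 3 (hv t).le ?_
      rw [hcube]
      have := pow_pos hε 3
      linarith
    · refine lt_of_pow_lt_pow_left₀ 3 (by positivity) ?_
      rw [hcube]
      have : 0 < 3 * u t ^ 2 * ε + 3 * u t * ε ^ 2 := by positivity
      linarith [show (u t + ε) ^ 3 = u t ^ 3 + ε ^ 3 + (3 * u t ^ 2 * ε + 3 * u t * ε ^ 2) by ring]

end IsInverseRadius

theorem lipschitzWith_one_div_max_sq {η : ℝ} (hη : 0 < η) :
    LipschitzWith (2 / η ^ 3).toNNReal fun u : ℝ => 1 / max u η ^ 2 := by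
  refine LipschitzWith.of_dist_le_mul fun p q => ?_
  rw [Real.coe_toNNReal _ (by positivity), Real.dist_eq, Real.dist_eq]
  have hp := le_max_right p η
  have hq := le_max_right q η
  have hpq := abs_max_sub_max_le_abs p q η
  set x := max p η
  set y := max q η
  have hx := hη.trans_le hp
  have hy := hη.trans_le hq
  have e : 1 / x ^ 2 - 1 / y ^ 2 = -(x - y) * (1 / (x * y ^ 2) + 1 / (x ^ 2 * y)) := by
    field_simp
    ring
  rw [e, abs_mul, abs_neg, abs_of_pos (a := 1 / (x * y ^ 2) + 1 / (x ^ 2 * y)) (by positivity),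
    mul_comm]
  refine mul_le_mul ?_ hpq (abs_nonneg _) (by positivity)
  have h1 : 1 / (x * y ^ 2) ≤ 1 / (η * η ^ 2) := by gcongr
  have h2 : 1 / (x ^ 2 * y) ≤ 1 / (η ^ 2 * η) := by gcongr
  calc _ ≤ _ := add_le_add h1 h2
    _ = _ := by field_simp; ring

/-- The reversible equation, with its singularity at `0` cut off and with `cos` of the angle as
independent variable, is solvable for all initial values. -/
theorem exists_hasDerivWithinAt_truncated (b2 a2 a4 x : ℝ) {η : ℝ} (hη : 0 < η) :
    ∃ V : ℝ → ℝ, V 1 = x ∧ ∀ c ∈ Icc (-1 : ℝ) 1,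
      HasDerivWithinAt V (b2 + (a2 * c ^ 2 + a4 * (1 - c ^ 2)) * (1 / max (V c) η ^ 2))
        (Icc (-1) 1) c := by
  have hη2 : 0 < η ^ 2 := by positivity
  have hcoef : ∀ c ∈ Icc (-1 : ℝ) 1, |a2 * c ^ 2 + a4 * (1 - c ^ 2)| ≤ |a2| + |a4| := by
    intro c hc
    have h1 : c ^ 2 ≤ 1 := by nlinarith [hc.1, hc.2]
    refine (abs_add_le _ _).trans (add_le_add ?_ ?_)
    · rw [abs_mul, abs_of_nonneg (sq_nonneg c)]
      exact mul_le_of_le_one_right (abs_nonneg _) h1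
    · rw [abs_mul, abs_of_nonneg (sub_nonneg.2 h1)]
      exact mul_le_of_le_one_right (abs_nonneg _) (by linarith [sq_nonneg c])
  set M : NNReal := (|a2| + |a4|).toNNReal
  have hM : (M : ℝ) = |a2| + |a4| := Real.coe_toNNReal _ (by positivity)
  set L : NNReal := (|b2| + (|a2| + |a4|) * (1 / η ^ 2)).toNNReal
  have hL : (L : ℝ) = |b2| + (|a2| + |a4|) * (1 / η ^ 2) := Real.coe_toNNReal _ (by positivity)
  have hPL : IsPicardLindelof
      (fun c v : ℝ => b2 + (a2 * c ^ 2 + a4 * (1 - c ^ 2)) * (1 / max v η ^ 2))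
      (⟨1, by norm_num, le_rfl⟩ : Icc (-1 : ℝ) 1) x (L * 2) 0 L
      (M * (2 / η ^ 3).toNNReal) := by
    refine ⟨fun c hc => LipschitzWith.lipschitzOnWith ?_, fun v _ => ?_, fun c hc v _ => ?_, ?_⟩
    · refine LipschitzWith.of_dist_le_mul fun p q => ?_
      have h := (lipschitzWith_one_div_max_sq hη).dist_le_mul p q
      rw [dist_add_left, Real.dist_eq, ← mul_sub, abs_mul, NNReal.coe_mul, hM, mul_assoc]
      exact mul_le_mul (hcoef c hc) h (abs_nonneg _) (by positivity)
    · fun_prop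
    · rw [hL, Real.norm_eq_abs]
      refine (abs_add_le _ _).trans (add_le_add_right ?_ _)
      rw [abs_mul]
      refine mul_le_mul (hcoef c hc) ?_ (abs_nonneg _) (by positivity)
      rw [abs_of_nonneg (by positivity)]
      exact one_div_le_one_div_of_le hη2 (pow_le_pow_left₀ hη.le (le_max_right _ _) 2)
    · norm_num
  exact hPL.exists_eq_forall_mem_Icc_hasDerivWithinAt₀

theorem abs_cubicCoeff_zero_zero_le (a2 a4 t : ℝ) : |cubicCoeff 0 a2 0 a4 t| ≤ |a2| + |a4| := by
  have hs := abs_sin_le_one t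
  have hc := abs_cos_le_one t
  have e : cubicCoeff 0 a2 0 a4 t = a2 * (cos t ^ 2 * sin t) + a4 * sin t ^ 3 := by
    simp only [cubicCoeff]
    ring
  rw [e]
  refine (abs_add_le _ _).trans (add_le_add ?_ ?_)
  · rw [abs_mul, abs_mul, abs_pow]
    exact mul_le_of_le_one_right (abs_nonneg _)
      (mul_le_one₀ (pow_le_one₀ (abs_nonneg _) hc) (abs_nonneg _) hs)
  · rw [abs_mul, abs_pow]
    exact mul_le_of_le_one_right (abs_nonneg _) (pow_le_one₀ (abs_nonneg _) hs)

/-- When `a1 = a3 = 0` the system is reversible and the orbits near a periodic one are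
periodic. -/
theorem IsInverseRadius.exists_near_of_reversible {b2 a2 a4 : ℝ} {u : ℝ → ℝ}
    (hu : IsInverseRadius b2 0 a2 0 a4 u) {T : ℝ} (hT : 0 < T) (huT : Function.Periodic u T)
    (hcos : Function.Periodic cos T) {ε : ℝ} (hε : 0 < ε) :
    ∃ v, IsInverseRadius b2 0 a2 0 a4 v ∧ Function.Periodic v T ∧
      ∀ t, u t < v t ∧ v t < u t + ε := by
  obtain ⟨s, hs⟩ := (exists_forall_le_and_exists_forall_ge hu.continuous hT huT).1
  set η := u s / 2
  have hη : 0 < η := half_pos (hu.1 s)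
  have huη : ∀ t, 2 * η ≤ u t := fun t => by
    have := hs t
    simp only [η]
    linarith
  set M : NNReal := (|a2| + |a4|).toNNReal
  have hM : (M : ℝ) = |a2| + |a4| := Real.coe_toNNReal _ (by positivity)
  set K : NNReal := M * (2 / η ^ 3).toNNReal
  set δ := min ε η / 2 / exp (K * T)
  have hmin : 0 < min ε η := lt_min hε hη
  have hδ : 0 < δ := by positivity
  obtain ⟨V, hV1, hV⟩ := exists_hasDerivWithinAt_truncated b2 a2 a4 (u 0 + δ) hη
  set v : ℝ → ℝ := fun t => V (cos t)
  have hv0 : v 0 = u 0 + δ := by simp only [v, cos_zero, hV1]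
  have hvT : Function.Periodic v T := fun t => by simp only [v, hcos t]
  have hvd : ∀ t, HasDerivAt v
      (-(b2 * sin t) - cubicCoeff 0 a2 0 a4 t * (1 / max (v t) η ^ 2)) t := fun t => by
    have h := (hV (cos t) (cos_mem_Icc t)).comp_hasDerivAt t (hasDerivAt_cos t)
      (Filter.Eventually.of_forall fun t => cos_mem_Icc t)
    refine h.congr_deriv ?_
    simp only [cubicCoeff, ← sin_sq, v]
    ring
  have hud : ∀ t, HasDerivAt u
      (-(b2 * sin t) - cubicCoeff 0 a2 0 a4 t * (1 / max (u t) η ^ 2)) t := fun t => by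
    refine (hu.2 t).congr_deriv ?_
    rw [max_eq_left (by linarith [huη t]), mul_one_div]
  have hlip : ∀ t, LipschitzWith K fun x : ℝ =>
      -(b2 * sin t) - cubicCoeff 0 a2 0 a4 t * (1 / max x η ^ 2) := fun t => by
    refine LipschitzWith.of_dist_le_mul fun p q => ?_
    have h := (lipschitzWith_one_div_max_sq hη).dist_le_mul p q
    rw [dist_sub_left, Real.dist_eq, ← mul_sub, abs_mul, NNReal.coe_mul, hM, mul_assoc]
    exact mul_le_mul (abs_cubicCoeff_zero_zero_le a2 a4 t) h (abs_nonneg _) (by positivity)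
  have hcv : Continuous v := continuous_iff_continuousAt.2 fun t => (hvd t).continuousAt
  have hclose : ∀ t ∈ Icc 0 T, |v t - u t| < min ε η := fun t ht => by
    have h := dist_le_of_trajectories_ODE (δ := δ) hlip hcv.continuousOn
      (fun t _ => (hvd t).hasDerivWithinAt) hu.continuous.continuousOn
      (fun t _ => (hud t).hasDerivWithinAt)
      (by rw [hv0, Real.dist_eq, add_sub_cancel_left, abs_of_pos hδ]) t ht
    rw [Real.dist_eq, sub_zero] at h
    calc |v t - u t| ≤ δ * exp (K * t) := h
      _ ≤ δ * exp (K * T) := by gcongr; exact ht.2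
      _ = min ε η / 2 := div_mul_cancel₀ _ (exp_pos _).ne'
      _ < min ε η := half_lt_self hmin
  have hclose' : ∀ t, |v t - u t| < min ε η := fun t => by
    obtain ⟨r, hr, hrt⟩ := (hvT.sub huT).exists_mem_Ico₀ hT t
    simp only [Pi.sub_apply] at hrt
    rw [hrt]
    exact hclose r ⟨hr.1, hr.2.le⟩
  have hvη : ∀ t, η < v t := fun t => by
    have := (abs_lt.1 ((hclose' t).trans_le (min_le_right _ _))).1
    linarith [huη t]
  have hvr : IsInverseRadius b2 0 a2 0 a4 v := by
    refine ⟨fun t => hη.trans (hvη t), fun t => (hvd t).congr_deriv ?_⟩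
    rw [max_eq_left (hvη t).le, mul_one_div]
  refine ⟨v, hvr, hvT, fun t => ⟨hu.lt_of_lt hvr (by linarith) t, ?_⟩⟩
  have := (abs_lt.1 ((hclose' t).trans_le (min_le_left _ _))).2
  linarith

/-- A non-constant solution, written in polar coordinates. -/
theorem IsSolutionE'.exists_isInverseRadius {b2 a1 a2 a3 a4 : ℝ} {f : ℝ → ℝ × ℝ}
    (hf : IsSolutionE' b2 a1 a2 a3 a4 f) (hne : ∃ t s, f t ≠ f s) :
    ∃ (u : ℝ → ℝ) (θ : ℝ), IsInverseRadius b2 a1 a2 a3 a4 u ∧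
      ∀ t, f t = polarCurve u (t + θ) := by
  have hx : ∀ t, HasDerivAt (fun t => (f t).1)
      (Pfun' b2 a1 a2 a3 a4 (f t).1 (f t).2) t := fun t =>
    (ContinuousLinearMap.fst ℝ ℝ ℝ).hasFDerivAt.comp_hasDerivAt t (hf t)
  have hy : ∀ t, HasDerivAt (fun t => (f t).2)
      (Qfun' b2 a1 a2 a3 a4 (f t).1 (f t).2) t := fun t =>
    (ContinuousLinearMap.snd ℝ ℝ ℝ).hasFDerivAt.comp_hasDerivAt t (hf t)
  have hcf : Continuous f := continuous_iff_continuousAt.2 fun t => (hf t).continuousAt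
  set g : ℝ → ℝ := fun t => Gfun b2 a1 a2 a3 a4 (f t).1 (f t).2
  have hg : Continuous g := by
    simp only [g, Gfun]
    fun_prop
  have hX := eq_mul_exp_integral_of_hasDerivAt
    (D := fun t => (f t).1 * cos t + (f t).2 * sin t) hg fun t => by
      refine (((hx t).mul (hasDerivAt_cos t)).add ((hy t).mul (hasDerivAt_sin t))).congr_deriv ?_
      simp only [Pfun', Qfun', g]
      ring
  have hY := eq_mul_exp_integral_of_hasDerivAt
    (D := fun t => (f t).2 * cos t - (f t).1 * sin t) hg fun t => by
      refine (((hy t).mul (hasDerivAt_cos t)).sub ((hx t).mul (hasDerivAt_sin t))).congr_deriv ?_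
      simp only [Pfun', Qfun', g]
      ring
  set I : ℝ → ℝ := fun t => ∫ s in (0 : ℝ)..t, g s
  have hI : ∀ t, HasDerivAt I (g t) t := fun t =>
    intervalIntegral.integral_hasDerivAt_right (hg.intervalIntegrable _ _)
      (hg.stronglyMeasurableAtFilter _ _) hg.continuousAt
  simp only [cos_zero, sin_zero, mul_one, mul_zero, add_zero, sub_zero] at hX hY
  set z : ℂ := ⟨(f 0).1, (f 0).2⟩
  have hre : (f 0).1 = ‖z‖ * cos z.arg := (Complex.norm_mul_cos_arg z).symm
  have him : (f 0).2 = ‖z‖ * sin z.arg := (Complex.norm_mul_sin_arg z).symm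
  have hf1 : ∀ t, (f t).1 = ‖z‖ * exp (I t) * cos (t + z.arg) := fun t => by
    have h1 := hX t
    have h2 := hY t
    rw [hre] at h1
    rw [him] at h2
    rw [cos_add]
    linear_combination cos t * h1 - sin t * h2 - (f t).1 * sin_sq_add_cos_sq t
  have hf2 : ∀ t, (f t).2 = ‖z‖ * exp (I t) * sin (t + z.arg) := fun t => by
    have h1 := hX t
    have h2 := hY t
    rw [hre] at h1
    rw [him] at h2
    rw [sin_add]
    linear_combination sin t * h1 + cos t * h2 - (f t).2 * sin_sq_add_cos_sq t
  have hz : 0 < ‖z‖ := by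
    refine (norm_nonneg z).lt_of_ne' fun h => ?_
    obtain ⟨t, s, hts⟩ := hne
    refine hts (Prod.ext ?_ ?_)
    · simp only [hf1, h, zero_mul]
    · simp only [hf2, h, zero_mul]
  set u : ℝ → ℝ := fun t => ‖z‖⁻¹ * exp (-I (t - z.arg)) with hudef
  have hu0 : ∀ t, 0 < u t := fun t => by positivity
  have hfu : ∀ t, f t = polarCurve u (t + z.arg) := fun t => by
    have h : ∀ c, ‖z‖ * exp (I t) * c = c / (‖z‖⁻¹ * exp (-I t)) := fun c => by
      rw [exp_neg]
      field_simp
    refine Prod.ext ?_ ?_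
    · simp only [hf1, h, polarCurve, hudef, add_sub_cancel_right]
    · simp only [hf2, h, polarCurve, hudef, add_sub_cancel_right]
  refine ⟨u, z.arg, ⟨hu0, fun t => ?_⟩, hfu⟩
  have hg' : g (t - z.arg) = Gfun b2 a1 a2 a3 a4 (cos t / u t) (sin t / u t) := by
    simp only [g, hfu, sub_add_cancel, polarCurve]
  have h0 := (hu0 t).ne'
  have hd : HasDerivAt u (-(u t * g (t - z.arg))) t := by
    refine (((hI (t - z.arg)).comp_sub_const t z.arg).neg.exp.const_mul ‖z‖⁻¹).congr_deriv ?_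
    simp only [hudef, Pi.neg_apply]
    ring
  refine hd.congr_deriv ?_
  rw [hg', Gfun, cubicCoeff]
  field_simp
  ring

theorem IsInverseRadius.eq_zero_or_of_periodic {b2 a1 a2 a3 a4 : ℝ} {u : ℝ → ℝ}
    (hu : IsInverseRadius b2 a1 a2 a3 a4 u) (h : 0 ≤ a1 * a3)
    (hper : Function.Periodic u (2 * π)) : b2 = 0 ∨ a1 = 0 ∧ a3 = 0 := by
  by_contra! hne
  obtain ⟨hb, hne⟩ := hne
  rcases mul_nonneg_iff.1 h with ⟨h1, h3⟩ | ⟨h1, h3⟩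
  · refine hu.not_periodic hb h1 h3 ((add_nonneg h1 h3).lt_of_ne' fun h0 => ?_) hper
    exact hne (by linarith) (by linarith)
  · refine hu.comp_neg.not_periodic hb (neg_nonneg.2 h1) (neg_nonneg.2 h3)
      ((add_nonneg (neg_nonneg.2 h1) (neg_nonneg.2 h3)).lt_of_ne' fun h0 => ?_) fun t => ?_
    · exact hne (by linarith) (by linarith)
    · beta_reduce
      rw [← hper (-(t + 2 * π))]
      congr 1
      ring

theorem no_limit_cycles (b2 a1 a2 a3 a4 : ℝ) (h : a1 * a3 ≥ 0) :
    ¬ ∃ f : ℝ → ℝ × ℝ, IsLimitCycleE' b2 a1 a2 a3 a4 f := by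
  rintro ⟨f, ⟨hsol, ⟨T, hT, hfT⟩, hne⟩, U, hU, hsub, hiso⟩
  obtain ⟨u, θ, hu, hfu⟩ := hsol.exists_isInverseRadius hne
  have hrange : range f = range (polarCurve u) := by
    rw [funext hfu]
    exact (Equiv.addRight θ).surjective.range_comp (polarCurve u)
  have hper : Function.Periodic (polarCurve u) T := fun t => by
    have := hfT (t - θ)
    rwa [hfu, hfu, sub_add_cancel, show t - θ + T + θ = t + T by ring] at this
  obtain ⟨huT, hcos, hsin⟩ := hu.periodic_of_periodic_polarCurve hper
  have hcenter : ∀ ε > 0, ∃ v, IsInverseRadius b2 a1 a2 a3 a4 v ∧ Function.Periodic v T ∧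
      ∀ t, u t < v t ∧ v t < u t + ε := by
    intro ε hε
    rcases hu.eq_zero_or_of_periodic h (hu.periodic_two_pi hT huT) with rfl | ⟨rfl, rfl⟩
    · exact hu.exists_near_of_linear_eq_zero huT hε
    · exact hu.exists_near_of_reversible hT huT hcos hε
  obtain ⟨g, hg, hgU, hgne⟩ := hu.exists_isPeriodicOrbitE'_range_ne hT hper huT
    (fun ε hε => by
      obtain ⟨v, hv, hvT, hvu⟩ := hcenter ε hε
      exact ⟨v, hv, fun t => by simp only [polarCurve, hvT t, hcos t, hsin t], hvu⟩)
    hU (hrange ▸ hsub)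
  exact hgne (hrange ▸ hiso g hg hgU)
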